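/- Limit inversion: The multi-valued map H := J ∘ lim⁻¹ : ℕ^ℕ ⇉ ℕ^ℕ is computable relative to the halting problem 0'; explicitly, there exists a total single-valued function I : ℕ^ℕ → ℕ^ℕ such that lim ∘ I = id and both I and J ∘ I are computable relative to 0'. -/

import Mathlib

open scoped Classical

namespace LimitComp

/-- Baire space `ℕ^ℕ`. -/
abbrev Baire : Type := ℕ → ℕ

/-- The finite prefix of length `k` of a point of Baire space. -/
def pre (p : Baire) (k : ℕ) : List ℕ := List.ofFn fun i : Fin k => p i

/-- Interleaving pairing `⟨q,p⟩(2n) = q(n)`, `⟨q,p⟩(2n+1) = p(n)`. -/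
def pairB (q p : Baire) : Baire := fun n => if n % 2 = 0 then q (n / 2) else p (n / 2)

/-- The `i`-th component of a tupling `⟨p₀,p₁,p₂,...⟩`. -/
def seqOf (p : Baire) (i : ℕ) : Baire := fun n => p (Nat.pair i n)

/-- Tupling `⟨p₀,p₁,p₂,...⟩` of a sequence of points of Baire space. -/
def tup (ps : ℕ → Baire) : Baire := fun m => ps m.unpair.1 m.unpair.2

/-- The limit map `lim :⊆ ℕ^ℕ → ℕ^ℕ`; it maps `⟨p₀,p₁,p₂,...⟩` to its pointwise
limit, which is defined whenever every coordinate is eventually constant. -/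
noncomputable def limB : Baire →. Baire := fun p =>
  ⟨∀ n, ∃ i₀, ∀ i, i₀ ≤ i → seqOf p i n = seqOf p i₀ n,
   fun h n => seqOf p (Classical.choose (h n)) n⟩

/-- Monotonicity of a finite approximation function under prefix extension
(this corresponds to a one-way output tape). -/
def PrefixMono (η : List ℕ → ℕ → Option ℕ) : Prop :=
  ∀ u v n y, u <+: v → η u n = some y → η v n = some y

/-- `η` approximates the partial function `F`: for every input in the domain of `F`
every output position is eventually filled with the correct output value. -/
def OneWayApprox (η : List ℕ → ℕ → Option ℕ) (F : Baire →. Baire) : Prop :=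
  ∀ p q, q ∈ F p → ∀ n, ∃ k, η (pre p k) n = some (q n)

/-- Computability for partial functions on Baire space: `F` is computed by a
Turing machine with one-way output tape, formalized via a computable monotone
finite approximation function. -/
def ComputableFn (F : Baire →. Baire) : Prop :=
  ∃ η : List ℕ → ℕ → Option ℕ, Computable₂ η ∧ PrefixMono η ∧ OneWayApprox η F

/-- `η` is a limit approximation of `F`: on every input in the domain of `F`,
every output cell eventually stabilizes to the correct output value. -/
def LimitApprox (η : List ℕ → ℕ → ℕ) (F : Baire →. Baire) : Prop :=
  ∀ p q, q ∈ F p → ∀ n, ∃ k₀, ∀ k, k₀ ≤ k → η (pre p k) n = q n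

/-- Limit computability for partial functions on Baire space: `F` is computed by
a Turing machine with a two-way output tape such that on inputs in the domain
every output cell eventually stabilizes. -/
def LimitComputableFn (F : Baire →. Baire) : Prop :=
  ∃ η : List ℕ → ℕ → ℕ, Computable₂ η ∧ LimitApprox η F

/-- The `i`-th Turing machine halts on input `p ∈ ℕ^ℕ` (i.e. it halts after
having read some finite prefix of `p`). -/
def haltsOn (i : ℕ) (p : Baire) : Prop :=
  ∃ k, ((Denumerable.ofNat Nat.Partrec.Code i).eval (Encodable.encode (pre p k))).Dom

/-- The Turing jump operator `J : ℕ^ℕ → ℕ^ℕ`. -/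
noncomputable def jump (p : Baire) : Baire := fun i => if haltsOn i p then 1 else 0

/-- The halting problem `0'`. -/
noncomputable def zero' : Baire := jump fun _ => 0

/-- `F` is computable relative to the oracle `q`. -/
def ComputableRel (q : Baire) (F : Baire →. Baire) : Prop :=
  ∃ G : Baire →. Baire, ComputableFn G ∧ ∀ p r, r ∈ F p → r ∈ G (pairB q p)

/-- `F` is limit computable relative to the oracle `q`. -/
def LimitComputableRel (q : Baire) (F : Baire →. Baire) : Prop :=
  ∃ G : Baire →. Baire, LimitComputableFn G ∧ ∀ p r, r ∈ F p → r ∈ G (pairB q p)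

/-- Turing reducibility for points of Baire space. -/
def TuringLe (p q : Baire) : Prop :=
  ∃ F : Baire →. Baire, ComputableFn F ∧ p ∈ F q

end LimitComp

namespace LimitComp

open Nat.Partrec (Code)
open Encodable Denumerable

/-! ### Prefixes and relative computability -/

theorem length_pre (p : Baire) (k : ℕ) : (pre p k).length = k := by simp [pre]

theorem getElem?_pre (p : Baire) {j k : ℕ} (h : j < k) : (pre p k)[j]? = some (p j) := by
  simp [pre, h]

theorem pre_succ (p : Baire) (k : ℕ) : pre p (k + 1) = pre p k ++ [p k] := by
  simp [pre, List.ofFn_succ_last, -List.ofFn_succ]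

theorem pre_prefix (p : Baire) {k l : ℕ} (h : k ≤ l) : pre p k <+: pre p l := by
  induction l, h using Nat.le_induction with
  | base => exact List.prefix_rfl
  | succ l _ ih => exact ih.trans (pre_succ p l ▸ List.prefix_append _ _)

theorem eq_pre_of_prefix {p : Baire} {k : ℕ} {w : List ℕ} (h : w <+: pre p k) :
    w = pre p w.length := by
  have hk : w.length ≤ k := by simpa [length_pre] using h.length_le
  exact (List.prefix_of_prefix_length_le h (pre_prefix p hk) (by simp [length_pre])).eq_of_length
    (by simp [length_pre])

theorem getElem?_of_prefix {u v : List ℕ} (h : u <+: v) {n y : ℕ} (hy : u[n]? = some y) :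
    v[n]? = some y := by
  obtain ⟨t, rfl⟩ := h
  obtain ⟨hn, _⟩ := List.getElem?_eq_some_iff.1 hy
  rw [List.getElem?_append_left hn, hy]

theorem pairB_even (q p : Baire) (n : ℕ) : pairB q p (2 * n) = q n := by simp [pairB]

theorem pairB_odd (q p : Baire) (n : ℕ) : pairB q p (2 * n + 1) = p n := by
  have : (2 * n + 1) / 2 = n := by omega
  simp [pairB, this, Nat.add_mod]

theorem computableRel_lift {q : Baire} {f : Baire → Baire} {η : List ℕ → ℕ → Option ℕ}
    (hη : Computable₂ η) (hmono : PrefixMono η)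
    (h : ∀ p n, ∃ k, η (pre (pairB q p) k) n = some (f p n)) :
    ComputableRel q (PFun.lift f) := by
  refine ⟨fun x => ⟨∀ n, ∃ y k, η (pre x k) n = some y, fun hx n => (hx n).choose⟩,
    ⟨η, hη, hmono, ?_⟩, ?_⟩
  · rintro x r ⟨hx, rfl⟩ n
    exact (hx n).choose_spec
  · intro p r hr
    obtain rfl : f p = r := by simpa [PFun.lift, eq_comm] using hr
    refine ⟨fun n => ⟨_, h p n⟩, funext fun n => ?_⟩
    generalize_proofs hx
    obtain ⟨k, hk⟩ := (hx n).choose_spec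
    obtain ⟨l, hl⟩ := h p n
    have h₁ := hmono _ _ _ _ (pre_prefix _ (le_max_left k l)) hk
    have h₂ := hmono _ _ _ _ (pre_prefix _ (le_max_right k l)) hl
    exact Option.some.inj (h₁.symm.trans h₂)

/-! ### Turning `Σ₁` questions into halting problems -/

theorem haltsOn_encode (c : Code) (p : Baire) :
    haltsOn (encode c) p ↔ ∃ k, (c.eval (encode (pre p k))).Dom := by
  simp [haltsOn]

theorem exists_index {α : Type*} [Primcodable α] {φ : α → ℕ → Bool} (hφ : Computable₂ φ) :
    ∃ idx : α → ℕ, Computable idx ∧ ∀ a p, haltsOn (idx a) p ↔ ∃ t, φ a t = true := by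
  have hf : Partrec fun a => Nat.rfind fun t => (Part.some (φ a t) : Part Bool) :=
    Partrec.rfind (p := fun a t => Part.some (φ a t)) hφ
  have hg : Nat.Partrec fun m => Part.bind (decode (α := α) m.unpair.1 : Option α)
      fun a => Nat.rfind fun t => Part.some (φ a t) :=
    Partrec.nat_iff.1 (Partrec.bind
      (Computable.ofOption (Computable.decode.comp (Computable.fst.comp Computable.unpair)))
      (hf.comp Computable.snd))
  obtain ⟨c, hc⟩ := Code.exists_code.1 hg
  refine ⟨fun a => encode (c.curry (encode a)), ?_, fun a p => ?_⟩
  · exact Computable.encode.comp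
      (Code.primrec₂_curry.to_comp.comp (Computable.const c) Computable.encode)
  · rw [haltsOn_encode]
    simp only [Code.eval_curry, hc, Nat.unpair_pair, encodek, Part.coe_some, Part.bind_some,
      exists_const]
    refine Nat.rfind_dom.trans ⟨fun ⟨t, ht, _⟩ => ⟨t, (Part.mem_some_iff.1 ht).symm⟩,
      fun ⟨t, ht⟩ => ⟨t, Part.mem_some_iff.2 ht.symm, fun _ => trivial⟩⟩

/-! ### Bounded search -/

/-- The least `t < N` with `φ t`, if there is one. -/
def search (φ : ℕ → Bool) (N : ℕ) : Option ℕ :=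
  Nat.rec none (fun t o => o <|> bif φ t then some t else none) N

theorem search_succ (φ : ℕ → Bool) (N : ℕ) :
    search φ (N + 1) = (search φ N <|> bif φ N then some N else none) := rfl

theorem search_mono {φ : ℕ → Bool} {M N t : ℕ} (h : M ≤ N) (ht : search φ M = some t) :
    search φ N = some t := by
  induction N, h using Nat.le_induction with
  | base => exact ht
  | succ N _ ih => simp [search_succ, ih]

theorem search_find {φ : ℕ → Bool} (h : ∃ t, φ t = true) :
    search φ (Nat.find h + 1) = some (Nat.find h) := by
  have hnone : ∀ N ≤ Nat.find h, search φ N = none := by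
    intro N
    induction N with
    | zero => exact fun _ => rfl
    | succ N ih =>
      intro hN
      have := Nat.find_min h (Nat.lt_of_succ_le hN)
      simp [search_succ, ih (by omega), this]
  simp [search_succ, hnone _ le_rfl, Nat.find_spec h]

theorem primrec_search {α : Type*} [Primcodable α] {φ : α → ℕ → Bool} (hφ : Primrec₂ φ) :
    Primrec₂ fun a N => search (φ a) N := by
  refine Primrec.nat_rec' (f := fun x : α × ℕ => x.2) (g := fun _ => (none : Option ℕ))
    (h := fun x y => y.2 <|> bif φ x.1 y.1 then some y.1 else none)
    Primrec.snd (Primrec.const _) ?_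
  have hy : Primrec fun z : (α × ℕ) × (ℕ × Option ℕ) => z.2.1 := Primrec.fst.comp Primrec.snd
  exact Primrec.option_orElse.comp (Primrec.snd.comp Primrec.snd)
    (Primrec.cond (hφ.comp (Primrec.fst.comp Primrec.fst) hy)
      (Primrec.option_some.comp hy) (Primrec.const none))

/-! ### The forcing conditions -/

/-- Extend `w` by the values of `x`, except that positions `⟨i, n⟩` with `n < a.length` get
the value `a[n]`. -/
def extend (a w x : List ℕ) : List ℕ :=
  x.foldl (fun v b => v ++ [(a[v.length.unpair.2]?).getD b]) w

theorem extend_concat (a w x : List ℕ) (b : ℕ) :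
    extend a w (x ++ [b]) =
      extend a w x ++ [(a[(extend a w x).length.unpair.2]?).getD b] := by
  simp [extend]

theorem length_extend (a w x : List ℕ) : (extend a w x).length = w.length + x.length := by
  induction x using List.reverseRecOn with
  | nil => rfl
  | append_singleton x b ih => simp [extend_concat, ih, add_assoc]

theorem prefix_extend (a w x : List ℕ) : w <+: extend a w x := by
  induction x using List.reverseRecOn with
  | nil => exact List.prefix_rfl
  | append_singleton x b ih => exact ih.trans (extend_concat a w x b ▸ List.prefix_append _ _)

theorem getElem?_extend {a w x : List ℕ} {j y : ℕ} (hw : w.length ≤ j)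
    (hj : j < (extend a w x).length) (hy : a[j.unpair.2]? = some y) :
    (extend a w x)[j]? = some y := by
  induction x using List.reverseRecOn with
  | nil => exact absurd hj (by simpa [extend] using hw)
  | append_singleton x b ih =>
    rw [extend_concat] at hj ⊢
    rcases lt_or_ge j (extend a w x).length with h | h
    · rw [List.getElem?_append_left h, ih h]
    · obtain rfl : j = (extend a w x).length := by simp at hj; omega
      simp [hy]

theorem exists_extend_eq_pre {a w : List ℕ} {r : Baire} (hw : w = pre r w.length)
    (hr : ∀ j y, w.length ≤ j → a[j.unpair.2]? = some y → r j = y) {k : ℕ} (hk : w.length ≤ k) :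
    ∃ x, extend a w x = pre r k := by
  induction k, hk using Nat.le_induction with
  | base => exact ⟨[], hw⟩
  | succ k hk ih =>
    obtain ⟨x, hx⟩ := ih
    refine ⟨x ++ [r k], ?_⟩
    rw [extend_concat, hx, length_pre, pre_succ]
    cases h : a[k.unpair.2]? with
    | none => rfl
    | some y => simp [hr k y hk h]

theorem primrec_extend :
    Primrec fun z : (List ℕ × List ℕ) × List ℕ => extend z.1.1 z.1.2 z.2 := by
  refine Primrec.list_foldl (h := fun (z : (List ℕ × List ℕ) × List ℕ) (y : List ℕ × ℕ) =>
    y.1 ++ [(z.1.1[y.1.length.unpair.2]?).getD y.2])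
    Primrec.snd (Primrec.snd.comp Primrec.fst) ?_
  have hv : Primrec fun y : ((List ℕ × List ℕ) × List ℕ) × (List ℕ × ℕ) => y.2.1 :=
    Primrec.fst.comp Primrec.snd
  exact Primrec.list_concat.comp hv (Primrec.option_getD.comp
    (Primrec.list_getElem?.comp (Primrec.fst.comp (Primrec.fst.comp Primrec.fst))
      (Primrec.snd.comp (Primrec.unpair.comp (Primrec.list_length.comp hv))))
    (Primrec.snd.comp Primrec.snd))

/-- A condition `(a, w)`: `w` is the part of the constructed point fixed so far, and every new
value in a column `n < a.length` has to be `a[n]`. -/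
abbrev Cond : Type := List ℕ × List ℕ

/-- `t = (x, k, m)` codes an extension of the condition on whose prefix of length `k` the machine
with index `c.1.length` halts within `m` steps. -/
def forcesHalt (c : Cond) (t : ℕ) : Bool :=
  (Code.evaln (ofNat (List ℕ × ℕ × ℕ) t).2.2 (ofNat Code c.1.length)
    (encode ((extend c.1 c.2 (ofNat (List ℕ × ℕ × ℕ) t).1).take
      (ofNat (List ℕ × ℕ × ℕ) t).2.1))).isSome

theorem primrec_forcesHalt : Primrec₂ forcesHalt := by
  have ht : Primrec fun z : Cond × ℕ => ofNat (List ℕ × ℕ × ℕ) z.2 :=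
    (Primrec.ofNat _).comp Primrec.snd
  exact Primrec.option_isSome.comp (Code.primrec_evaln.comp (Primrec.pair
    (Primrec.pair (Primrec.snd.comp (Primrec.snd.comp ht))
      ((Primrec.ofNat Code).comp (Primrec.list_length.comp (Primrec.fst.comp Primrec.fst))))
    (Primrec.encode.comp (Primrec.list_take.comp (Primrec.fst.comp (Primrec.snd.comp ht))
      (primrec_extend.comp (Primrec.pair Primrec.fst (Primrec.fst.comp ht)))))))

theorem exists_forcesHalt (c : Cond) :
    (∃ t, forcesHalt c t = true) ↔ ∃ x k, ((ofNat Code c.1.length).eval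
      (encode ((extend c.1 c.2 x).take k))).Dom := by
  constructor
  · rintro ⟨t, ht⟩
    obtain ⟨y, hy⟩ := Option.isSome_iff_exists.1 ht
    exact ⟨_, _, Part.dom_iff_mem.2 ⟨y, Code.evaln_complete.2 ⟨_, hy⟩⟩⟩
  · rintro ⟨x, k, h⟩
    obtain ⟨y, hy⟩ := Part.dom_iff_mem.1 h
    obtain ⟨m, hm⟩ := Code.evaln_complete.1 hy
    exact ⟨encode (x, k, m), Option.isSome_iff_exists.2 ⟨y, by simpa [forcesHalt] using hm⟩⟩

/-- The values used to extend the condition `c` in order to decide halting. -/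
noncomputable def decider (c : Cond) : List ℕ :=
  if h : ∃ t, forcesHalt c t = true then (ofNat (List ℕ × ℕ × ℕ) (Nat.find h)).1 else []

/-! ### The construction -/

/-- The next condition, given the next value `y` of the input and the values `x` deciding the
current halting question. -/
def advance (c : Cond) (y : ℕ) (x : List ℕ) : Cond :=
  (c.1 ++ [y], extend c.1 c.2 (x ++ [0]))

/-- The sequence of conditions constructed from `p`. -/
noncomputable def stage (p : Baire) : ℕ → Cond
  | 0 => ([], [])
  | s + 1 => advance (stage p s) (p s) (decider (stage p s))

theorem stage_fst (p : Baire) (s : ℕ) : (stage p s).1 = pre p s := by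
  induction s with
  | zero => rfl
  | succ s ih => simp [stage, advance, ih, pre_succ]

theorem le_length_stage (p : Baire) (s : ℕ) : s ≤ (stage p s).2.length := by
  induction s with
  | zero => exact Nat.zero_le _
  | succ s ih => simp [stage, advance, length_extend]; omega

theorem stage_prefix (p : Baire) {s t : ℕ} (h : s ≤ t) : (stage p s).2 <+: (stage p t).2 := by
  induction t, h using Nat.le_induction with
  | base => exact List.prefix_rfl
  | succ t _ ih => exact ih.trans (prefix_extend _ _ _)

/-- The inverse of the limit map: the point determined by the words of the conditions. -/
noncomputable def limInv (p : Baire) : Baire := fun n => (stage p (n + 1)).2.getD n 0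

theorem getElem?_stage (p : Baire) {s j : ℕ} (h : j < (stage p s).2.length) :
    (stage p s).2[j]? = some (limInv p j) := by
  have hj : j < (stage p (j + 1)).2.length := le_length_stage p (j + 1)
  have hv : (stage p (j + 1)).2[j]? = some (limInv p j) := by
    simp [limInv, List.getElem?_eq_getElem hj]
  rcases le_total s (j + 1) with hs | hs
  · have h' := List.getElem?_eq_getElem h
    rw [h', ← getElem?_of_prefix (stage_prefix p hs) h', hv]
  · exact getElem?_of_prefix (stage_prefix p hs) hv

theorem stage_snd (p : Baire) (s : ℕ) : (stage p s).2 = pre (limInv p) (stage p s).2.length := by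
  refine List.ext_getElem? fun j => ?_
  rcases lt_or_ge j (stage p s).2.length with h | h
  · rw [getElem?_stage p h, getElem?_pre _ h]
  · rw [List.getElem?_eq_none h, List.getElem?_eq_none (by simpa [length_pre] using h)]

theorem limInv_of_le (p : Baire) {s j : ℕ} (hj : (stage p s).2.length ≤ j)
    (hs : j.unpair.2 < s) : limInv p j = p j.unpair.2 := by
  have key : ∀ t, s ≤ t → j < (stage p t).2.length → limInv p j = p j.unpair.2 := by
    intro t ht
    induction t, ht using Nat.le_induction with
    | base => intro h; omega
    | succ t ht ih =>
      intro h
      rcases lt_or_ge j (stage p t).2.length with h' | h'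
      · exact ih h'
      · have h₁ := getElem?_stage p h
        have h₂ : (stage p (t + 1)).2[j]? = some (p j.unpair.2) :=
          getElem?_extend h' h (by rw [stage_fst, getElem?_pre]; omega)
        exact Option.some.inj (h₁.symm.trans h₂)
  exact key (s + j + 1) (by omega) (by have := le_length_stage p (s + j + 1); omega)

theorem limB_limInv (p : Baire) : limB (limInv p) = Part.some p := by
  have h : ∀ n i, (stage p (n + 1)).2.length ≤ i → seqOf (limInv p) i n = p n := by
    intro n i hi
    have := limInv_of_le p (s := n + 1) (j := Nat.pair i n) (hi.trans (Nat.left_le_pair i n))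
      (by simp)
    simpa [seqOf] using this
  refine Part.eq_some_iff.2 ⟨fun n => ⟨_, fun i hi => (h n i hi).trans (h n _ le_rfl).symm⟩, ?_⟩
  funext n
  generalize_proofs hd
  change seqOf (limInv p) (hd n).choose n = p n
  rw [← (hd n).choose_spec _ (le_max_left _ (stage p (n + 1)).2.length),
    h n _ (le_max_right _ _)]

theorem haltsOn_limInv (p : Baire) (s : ℕ) :
    haltsOn s (limInv p) ↔ ∃ t, forcesHalt (stage p s) t = true := by
  have hlen : (stage p s).1.length = s := by rw [stage_fst, length_pre]
  constructor
  · rintro ⟨k, hk⟩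
    obtain ⟨x, hx⟩ := exists_extend_eq_pre (a := (stage p s).1) (stage_snd p s)
      (fun j y hj hy => by
        obtain ⟨hs, -⟩ := List.getElem?_eq_some_iff.1 hy
        rw [hlen] at hs
        rw [stage_fst, getElem?_pre _ hs] at hy
        exact (limInv_of_le p hj hs).trans (Option.some.inj hy))
      (le_max_right k (stage p s).2.length)
    refine (exists_forcesHalt _).2 ⟨x, k, ?_⟩
    have htake : (pre (limInv p) (max k (stage p s).2.length)).take k = pre (limInv p) k := by
      have := List.prefix_iff_eq_take.1
        (pre_prefix (limInv p) (le_max_left k (stage p s).2.length))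
      rw [length_pre] at this
      exact this.symm
    rwa [hx, htake, hlen]
  · intro h
    have hfind := Nat.find_spec h
    obtain ⟨y, hy⟩ := Option.isSome_iff_exists.1 hfind
    set t := ofNat (List ℕ × ℕ × ℕ) (Nat.find h)
    have hdom : ((ofNat Code (stage p s).1.length).eval
        (encode ((extend (stage p s).1 (stage p s).2 t.1).take t.2.1))).Dom :=
      Part.dom_iff_mem.2 ⟨y, Code.evaln_complete.2 ⟨_, hy⟩⟩
    have hpre : extend (stage p s).1 (stage p s).2 t.1 <+: (stage p (s + 1)).2 := by
      simp only [stage, advance, decider, dif_pos h, extend_concat]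
      exact List.prefix_append _ _
    have hpre' := (List.take_prefix t.2.1 _).trans hpre
    rw [stage_snd p (s + 1)] at hpre'
    rw [eq_pre_of_prefix hpre', hlen] at hdom
    exact ⟨_, hdom⟩

/-! ### Computing the construction from the halting problem -/

/-- Approximation of `decider` with search bound `N`, where `z` answers whether the search will
succeed. -/
def deciderApprox (c : Cond) (N z : ℕ) : Option (List ℕ) :=
  Nat.casesOn z (some []) fun _ =>
    (search (forcesHalt c) N).map fun t => (ofNat (List ℕ × ℕ × ℕ) t).1

/-- One step of the construction, reading the halting problem and the input from `u`. -/
def stepApprox (idx : Cond → ℕ) (u : List ℕ) (c : Cond) : Option Cond :=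
  (u[2 * idx c]?).bind fun z => (u[2 * c.1.length + 1]?).bind fun y =>
    (deciderApprox c u.length z).map (advance c y)

/-- The sequence of conditions as far as it can be computed from the finite prefix `u`. -/
def stageApprox (idx : Cond → ℕ) (u : List ℕ) (s : ℕ) : Option Cond :=
  Nat.rec (some ([], [])) (fun _ o => o.bind (stepApprox idx u)) s

theorem stepApprox_eq_some {idx : Cond → ℕ} {u : List ℕ} {c d : Cond} :
    stepApprox idx u c = some d ↔ ∃ z y x, u[2 * idx c]? = some z ∧
      u[2 * c.1.length + 1]? = some y ∧ deciderApprox c u.length z = some x ∧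
      advance c y x = d := by
  simp only [stepApprox, Option.bind_eq_some_iff, Option.map_eq_some_iff]
  tauto

theorem deciderApprox_mono {c : Cond} {M N z : ℕ} {x : List ℕ} (h : M ≤ N)
    (hx : deciderApprox c M z = some x) : deciderApprox c N z = some x := by
  cases z with
  | zero => exact hx
  | succ z =>
    obtain ⟨t, ht, rfl⟩ := Option.map_eq_some_iff.1 hx
    exact Option.map_eq_some_iff.2 ⟨t, search_mono h ht, rfl⟩

theorem stepApprox_mono {idx : Cond → ℕ} {u v : List ℕ} (h : u <+: v) {c d : Cond}
    (hd : stepApprox idx u c = some d) : stepApprox idx v c = some d := by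
  obtain ⟨z, y, x, hz, hy, hx, rfl⟩ := stepApprox_eq_some.1 hd
  exact stepApprox_eq_some.2 ⟨z, y, x, getElem?_of_prefix h hz, getElem?_of_prefix h hy,
    deciderApprox_mono h.length_le hx, rfl⟩

theorem stageApprox_succ (idx : Cond → ℕ) (u : List ℕ) (s : ℕ) :
    stageApprox idx u (s + 1) = (stageApprox idx u s).bind (stepApprox idx u) := rfl

theorem stageApprox_mono {idx : Cond → ℕ} {u v : List ℕ} (h : u <+: v) {s : ℕ} {c : Cond}
    (hc : stageApprox idx u s = some c) : stageApprox idx v s = some c := by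
  induction s generalizing c with
  | zero => exact hc
  | succ s ih =>
    obtain ⟨d, hd, hdc⟩ := Option.bind_eq_some_iff.1 hc
    exact Option.bind_eq_some_iff.2 ⟨d, ih hd, stepApprox_mono h hdc⟩

theorem exists_deciderApprox (c : Cond) :
    ∃ N, deciderApprox c N (if ∃ t, forcesHalt c t = true then 1 else 0) = some (decider c) := by
  by_cases h : ∃ t, forcesHalt c t = true
  · refine ⟨Nat.find h + 1, ?_⟩
    rw [if_pos h]
    simp [deciderApprox, search_find h, decider, dif_pos h]
  · exact ⟨0, by rw [if_neg h]; simp [deciderApprox, decider, dif_neg h]⟩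

section Oracle

variable {idx : Cond → ℕ}

theorem zero'_index (hidx : ∀ c p, haltsOn (idx c) p ↔ ∃ t, forcesHalt c t = true) (c : Cond) :
    zero' (idx c) = if ∃ t, forcesHalt c t = true then 1 else 0 := by
  simp only [zero', jump, hidx]

theorem exists_stageApprox (hidx : ∀ c p, haltsOn (idx c) p ↔ ∃ t, forcesHalt c t = true)
    (p : Baire) (s : ℕ) : ∃ k, stageApprox idx (pre (pairB zero' p) k) s = some (stage p s) := by
  induction s with
  | zero => exact ⟨0, rfl⟩
  | succ s ih =>
    obtain ⟨k, hk⟩ := ih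
    obtain ⟨N, hN⟩ := exists_deciderApprox (stage p s)
    have hlen : (stage p s).1.length = s := by rw [stage_fst, length_pre]
    refine ⟨max k (max N (2 * idx (stage p s) + 2 * s + 2)), ?_⟩
    rw [stageApprox_succ, stageApprox_mono (pre_prefix _ (le_max_left _ _)) hk]
    refine stepApprox_eq_some.2 ⟨_, _, decider (stage p s), getElem?_pre _ (by omega),
      getElem?_pre _ (by omega), ?_, ?_⟩
    · rw [pairB_even, zero'_index hidx, length_pre]
      exact deciderApprox_mono (by omega) hN
    · rw [pairB_odd, hlen]
      rfl

theorem primrec_deciderApprox :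
    Primrec fun z : Cond × ℕ × ℕ => deciderApprox z.1 z.2.1 z.2.2 := by
  refine Primrec.nat_casesOn (f := fun z : Cond × ℕ × ℕ => z.2.2) (g := fun _ => some [])
    (h := fun z _ => (search (forcesHalt z.1) z.2.1).map fun t => (ofNat (List ℕ × ℕ × ℕ) t).1)
    (Primrec.snd.comp Primrec.snd) (Primrec.const _) ?_
  exact Primrec.option_map
    ((primrec_search primrec_forcesHalt).comp (Primrec.fst.comp Primrec.fst)
      (Primrec.fst.comp (Primrec.snd.comp Primrec.fst)))
    (Primrec.fst.comp ((Primrec.ofNat (List ℕ × ℕ × ℕ)).comp Primrec.snd))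

theorem primrec_advance :
    Primrec fun z : (Cond × ℕ) × List ℕ => advance z.1.1 z.1.2 z.2 := by
  have hc : Primrec fun z : (Cond × ℕ) × List ℕ => z.1.1 := Primrec.fst.comp Primrec.fst
  exact Primrec.pair
    (Primrec.list_concat.comp (Primrec.fst.comp hc) (Primrec.snd.comp Primrec.fst))
    (primrec_extend.comp (Primrec.pair hc
      (Primrec.list_concat.comp Primrec.snd (Primrec.const 0))))

theorem computable_stepApprox (h : Computable idx) : Computable₂ (stepApprox idx) := by
  have hdouble : Primrec fun n : ℕ => 2 * n := Primrec.nat_mul.comp (Primrec.const 2) Primrec.id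
  have hu : Primrec fun z : (List ℕ × Cond) × ℕ => z.1.1 := Primrec.fst.comp Primrec.fst
  have hc : Primrec fun z : (List ℕ × Cond) × ℕ => z.1.2 := Primrec.snd.comp Primrec.fst
  refine Computable.option_bind (f := fun z : List ℕ × Cond => z.1[2 * idx z.2]?)
    (g := fun z b => (z.1[2 * z.2.1.length + 1]?).bind fun y =>
      (deciderApprox z.2 z.1.length b).map (advance z.2 y))
    (Computable.list_getElem?.comp Computable.fst
      (hdouble.to_comp.comp (h.comp Computable.snd))) (Primrec.to_comp ?_)
  refine Primrec.option_bind
    (f := fun z : (List ℕ × Cond) × ℕ => z.1.1[2 * z.1.2.1.length + 1]?)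
    (g := fun z y => (deciderApprox z.1.2 z.1.1.length z.2).map (advance z.1.2 y))
    (Primrec.list_getElem?.comp hu (Primrec.succ.comp
      (hdouble.comp (Primrec.list_length.comp (Primrec.fst.comp hc))))) ?_
  refine Primrec.option_map
    (f := fun z : ((List ℕ × Cond) × ℕ) × ℕ => deciderApprox z.1.1.2 z.1.1.1.length z.1.2)
    (g := fun z x => advance z.1.1.2 z.2 x) ?_ ?_
  · exact primrec_deciderApprox.comp (Primrec.pair (hc.comp Primrec.fst)
      (Primrec.pair (Primrec.list_length.comp (hu.comp Primrec.fst))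
        (Primrec.snd.comp Primrec.fst)))
  · have hx : Primrec fun z : (((List ℕ × Cond) × ℕ) × ℕ) × List ℕ =>
        ((z.1.1.1.2, z.1.2), z.2) :=
      Primrec.pair (Primrec.pair (hc.comp (Primrec.fst.comp Primrec.fst))
        (Primrec.snd.comp Primrec.fst)) Primrec.snd
    exact (primrec_advance.comp hx).to₂

theorem computable_stageApprox (h : Computable idx) : Computable₂ (stageApprox idx) := by
  refine Computable.nat_rec (f := fun z : List ℕ × ℕ => z.2)
    (g := fun _ => (some ([], []) : Option Cond))
    (h := fun z y => y.2.bind (stepApprox idx z.1)) Computable.snd (Computable.const _) ?_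
  exact Computable.option_bind (f := fun z : (List ℕ × ℕ) × (ℕ × Option Cond) => z.2.2)
    (g := fun z c => stepApprox idx z.1.1 c) (Computable.snd.comp Computable.snd)
    ((computable_stepApprox h).comp
      (Computable.fst.comp (Computable.fst.comp Computable.fst)) Computable.snd)

theorem computableRel_limInv (h : Computable idx)
    (hidx : ∀ c p, haltsOn (idx c) p ↔ ∃ t, forcesHalt c t = true) :
    ComputableRel zero' (PFun.lift limInv) := by
  refine computableRel_lift
    (η := fun u n => (stageApprox idx u (n + 1)).map fun c => c.2.getD n 0) ?_ ?_ ?_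
  · exact Computable.option_map
      ((computable_stageApprox h).comp Computable.fst (Computable.succ.comp Computable.snd))
      ((Primrec.list_getD 0).comp (Primrec.snd.comp Primrec.snd)
        (Primrec.snd.comp Primrec.fst)).to_comp
  · intro u v n y huv hu
    obtain ⟨c, hc, rfl⟩ := Option.map_eq_some_iff.1 hu
    exact Option.map_eq_some_iff.2 ⟨c, stageApprox_mono huv hc, rfl⟩
  · intro p n
    obtain ⟨k, hk⟩ := exists_stageApprox hidx p (n + 1)
    exact ⟨k, Option.map_eq_some_iff.2 ⟨_, hk, rfl⟩⟩

theorem computableRel_jump_limInv (h : Computable idx)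
    (hidx : ∀ c p, haltsOn (idx c) p ↔ ∃ t, forcesHalt c t = true) :
    ComputableRel zero' (PFun.lift fun p => jump (limInv p)) := by
  refine computableRel_lift
    (η := fun u n => (stageApprox idx u n).bind fun c => u[2 * idx c]?) ?_ ?_ ?_
  · exact Computable.option_bind (computable_stageApprox h)
      (Computable.list_getElem?.comp (Computable.fst.comp Computable.fst)
        ((Primrec.nat_mul.comp (Primrec.const 2) Primrec.id).to_comp.comp
          (h.comp Computable.snd)))
  · intro u v n y huv hu
    obtain ⟨c, hc, hy⟩ := Option.bind_eq_some_iff.1 hu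
    exact Option.bind_eq_some_iff.2 ⟨c, stageApprox_mono huv hc, getElem?_of_prefix huv hy⟩
  · intro p n
    obtain ⟨k, hk⟩ := exists_stageApprox hidx p n
    refine ⟨max k (2 * idx (stage p n) + 1), Option.bind_eq_some_iff.2
      ⟨_, stageApprox_mono (pre_prefix _ (le_max_left _ _)) hk, ?_⟩⟩
    rw [getElem?_pre _ (by omega), pairB_even, zero'_index hidx]
    simp only [jump, haltsOn_limInv]

end Oracle

/-- **Limit inversion.** The multi-valued map `H := J ∘ lim⁻¹ : ℕ^ℕ ⇉ ℕ^ℕ` is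
computable relative to the halting problem `0'`; explicitly, there exists a
total single-valued `I : ℕ^ℕ → ℕ^ℕ` such that `lim ∘ I = id` and both `I` and
`J ∘ I` are computable relative to `0'`. -/
theorem limit_inversion :
    (∃ F : Baire →. Baire, ComputableRel zero' F ∧
      ∀ p : Baire, ∃ r : Baire, limB r = Part.some p ∧ jump r ∈ F p) ∧
    ∃ I : Baire → Baire,
      (∀ p, limB (I p) = Part.some p) ∧
      ComputableRel zero' (PFun.lift I) ∧
      ComputableRel zero' (PFun.lift fun p => jump (I p)) := by
  obtain ⟨idx, h, hidx⟩ := exists_index primrec_forcesHalt.to_comp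
  have hJ := computableRel_jump_limInv h hidx
  exact ⟨⟨_, hJ, fun p => ⟨limInv p, limB_limInv p, Part.mem_some _⟩⟩,
    limInv, limB_limInv, computableRel_limInv h hidx, hJ⟩

end LimitComp
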